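/- For every integer d ≥ 2, the graph Lad_d (the square of the path on 2d vertices) has strong rainbow connection number src(Lad_d) = d. -/

import Mathlib

open SimpleGraph

/-- An edge-coloring `c` (colors on unordered pairs; only values on edges matter)
is a rainbow coloring of `G` if every pair of vertices is joined by a path
whose edges receive pairwise distinct colors. -/
def IsRainbowColoring {V α : Type*} (G : SimpleGraph V) (c : Sym2 V → α) : Prop :=
  ∀ u v : V, ∃ p : G.Walk u v, p.IsPath ∧ (p.edges.map c).Nodup

/-- The rainbow connection number: the least `n` such that `G` has a rainbow
coloring using colors from `Fin n`. -/
noncomputable def rc {V : Type*} (G : SimpleGraph V) : ℕ :=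
  sInf {n : ℕ | ∃ c : Sym2 V → Fin n, IsRainbowColoring G c}

/-- The eccentricity of a vertex: the largest distance from it to another vertex. -/
noncomputable def eccentricity {V : Type*} [Fintype V] (G : SimpleGraph V) (v : V) : ℕ :=
  Finset.univ.sup fun u => G.dist v u

/-- The diameter: the largest distance between a pair of vertices. -/
noncomputable def graphDiam {V : Type*} [Fintype V] (G : SimpleGraph V) : ℕ :=
  Finset.univ.sup fun p : V × V => G.dist p.1 p.2

/-- The radius: the least eccentricity of a vertex. -/
noncomputable def graphRadius {V : Type*} [Fintype V] (G : SimpleGraph V) : ℕ :=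
  sInf (Set.range (eccentricity G))

/-- An edge-coloring `c` is a strong rainbow coloring of `G` if every pair of
vertices is joined by a rainbow geodesic: a path with pairwise distinctly
colored edges whose length equals the distance between its endpoints. -/
def IsStrongRainbowColoring {V α : Type*} (G : SimpleGraph V) (c : Sym2 V → α) : Prop :=
  ∀ u v : V, ∃ p : G.Walk u v, p.IsPath ∧ (p.edges.map c).Nodup ∧ p.length = G.dist u v

/-- The strong rainbow connection number: the least `n` such that `G` has a
strong rainbow coloring using colors from `Fin n`. -/
noncomputable def src {V : Type*} (G : SimpleGraph V) : ℕ :=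
  sInf {n : ℕ | ∃ c : Sym2 V → Fin n, IsStrongRainbowColoring G c}

/-- The square of the path on `n` vertices: distinct vertices `i`, `j` are
adjacent iff `|i - j| ≤ 2`. For `n = 2 * d` this is the graph `Lad_d`. -/
def lad (n : ℕ) : SimpleGraph (Fin n) :=
  SimpleGraph.fromRel fun i j => |(i : ℤ) - (j : ℤ)| ≤ 2

theorem lad_adj_iff {n : ℕ} {i j : Fin n} :
    (lad n).Adj i j ↔ i ≠ j ∧ (i : ℕ) ≤ j + 2 ∧ (j : ℕ) ≤ i + 2 := by
  simp only [lad, SimpleGraph.fromRel_adj, abs_le]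
  refine and_congr_right fun _ => ?_
  omega

theorem lad_walk_le {n : ℕ} {i j : Fin n} (p : (lad n).Walk i j) :
    (j : ℕ) ≤ i + 2 * p.length := by
  induction p with
  | nil => simp
  | cons h p ih =>
    have := (lad_adj_iff.1 h).2
    rw [Walk.length_cons]
    omega

/-- The coloring of `lad (2 * d)` that gives an edge joining vertices of equal parity the color
half its smaller end (rounded down), and every other edge the color `d - 1`. -/
def ladColoring (d : ℕ) : Sym2 (Fin (2 * d)) → Fin d :=
  Sym2.lift ⟨fun i j => ⟨if (i : ℕ) % 2 = j % 2 then min (i : ℕ) j / 2 else d - 1, by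
    have := i.isLt
    split <;> omega⟩, fun i j => by simp only [eq_comm, min_comm]⟩

theorem ladColoring_mk {d : ℕ} (i j : Fin (2 * d)) :
    (ladColoring d s(i, j) : ℕ) = if (i : ℕ) % 2 = j % 2 then min (i : ℕ) j / 2 else d - 1 :=
  rfl

theorem exists_rainbow_walk_of_even {d : ℕ} (k : ℕ) (i j : Fin (2 * d))
    (h : (j : ℕ) = i + 2 * k) :
    ∃ p : (lad (2 * d)).Walk i j, p.length = k ∧ (p.edges.map (ladColoring d)).Nodup ∧
      ∀ x ∈ p.edges.map (ladColoring d), (i : ℕ) / 2 ≤ x ∧ (x : ℕ) < j / 2 := by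
  induction k generalizing i with
  | zero =>
    obtain rfl : i = j := Fin.ext (by omega)
    exact ⟨Walk.nil, by simp⟩
  | succ k ih =>
    let m : Fin (2 * d) := ⟨i + 2, by omega⟩
    have hm : (m : ℕ) = i + 2 := rfl
    obtain ⟨p, hp, hn, hx⟩ := ih m (by omega)
    have hadj : (lad (2 * d)).Adj i m := lad_adj_iff.2 ⟨Fin.ne_of_val_ne (by omega), by omega⟩
    have hc : (ladColoring d s(i, m) : ℕ) = i / 2 := by
      rw [ladColoring_mk, if_pos (by omega), min_eq_left (by omega)]
    refine ⟨Walk.cons hadj p, by simp [hp], ?_, ?_⟩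
    · rw [Walk.edges_cons, List.map_cons, List.nodup_cons]
      refine ⟨fun hmem => ?_, hn⟩
      have := hx _ hmem
      omega
    · rw [Walk.edges_cons, List.map_cons, List.forall_mem_cons]
      refine ⟨by omega, fun x hxm => ?_⟩
      have := hx x hxm
      omega

theorem exists_rainbow_walk {d : ℕ} (i j : Fin (2 * d)) (h : i ≤ j) :
    ∃ p : (lad (2 * d)).Walk i j, 2 * p.length ≤ (j - i : ℕ) + 1 ∧
      (p.edges.map (ladColoring d)).Nodup := by
  rw [Fin.le_def] at h
  by_cases hpar : (i : ℕ) % 2 = j % 2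
  · obtain ⟨p, hp, hn, -⟩ := exists_rainbow_walk_of_even ((j - i : ℕ) / 2) i j (by omega)
    exact ⟨p, by omega, hn⟩
  · let m : Fin (2 * d) := ⟨i + 1, by omega⟩
    have hm : (m : ℕ) = i + 1 := rfl
    obtain ⟨p, hp, hn, hx⟩ := exists_rainbow_walk_of_even ((j - m : ℕ) / 2) m j (by omega)
    have hadj : (lad (2 * d)).Adj i m := lad_adj_iff.2 ⟨Fin.ne_of_val_ne (by omega), by omega⟩
    have hc : (ladColoring d s(i, m) : ℕ) = d - 1 := by
      rw [ladColoring_mk, if_neg (by omega)]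
    refine ⟨Walk.cons hadj p, by rw [Walk.length_cons]; omega, ?_⟩
    rw [Walk.edges_cons, List.map_cons, List.nodup_cons]
    refine ⟨fun hmem => ?_, hn⟩
    have := hx _ hmem
    omega

theorem isStrongRainbowColoring_ladColoring (d : ℕ) :
    IsStrongRainbowColoring (lad (2 * d)) (ladColoring d) := by
  have key (i j : Fin (2 * d)) (h : i ≤ j) : ∃ p : (lad (2 * d)).Walk i j,
      p.IsPath ∧ (p.edges.map (ladColoring d)).Nodup ∧ p.length = (lad (2 * d)).dist i j := by
    obtain ⟨p, hp, hn⟩ := exists_rainbow_walk i j h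
    obtain ⟨q, hq⟩ := p.reachable.exists_walk_length_eq_dist
    have hle := lad_walk_le q
    have hdist := SimpleGraph.dist_le p
    have heq : p.length = (lad (2 * d)).dist i j := by
      rw [Fin.le_def] at h
      omega
    exact ⟨p, p.isPath_of_length_eq_dist heq, hn, heq⟩
  intro u v
  rcases le_total u v with h | h
  · exact key u v h
  · obtain ⟨p, hp, hn, hl⟩ := key v u h
    refine ⟨p.reverse, hp.reverse, ?_, ?_⟩
    · rwa [Walk.edges_reverse, List.map_reverse, List.nodup_reverse]
    · rw [Walk.length_reverse, hl, SimpleGraph.dist_comm]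

/-- For every `d ≥ 2`, the graph `Lad_d` (the square of the path on `2d` vertices)
has strong rainbow connection number `d`. -/
theorem lad_src (d : ℕ) (hd : 2 ≤ d) : src (lad (2 * d)) = d := by
  refine le_antisymm (Nat.sInf_le ⟨_, isStrongRainbowColoring_ladColoring d⟩)
    (le_csInf ⟨d, _, isStrongRainbowColoring_ladColoring d⟩ ?_)
  rintro n ⟨c, hc⟩
  obtain ⟨p, -, hn, -⟩ := hc ⟨0, by omega⟩ ⟨2 * d - 1, by omega⟩
  have hcard := hn.length_le_card
  rw [List.length_map, Walk.length_edges, Fintype.card_fin] at hcard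
  have hle := lad_walk_le p
  dsimp only at hle
  omega
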